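/- Let θ ∈ ℝ, b > 0, and let X, Y be independent real random variables each with the Laplace density p_{θ,b}(x) = (1/(2b)) exp(−|x − θ|/b). Then for every ε ≥ 0, P( min(X,Y) ≤ θ ≤ max(X,Y) and 0 < (X + Y)/2 − θ ≤ ε ) = (1 − e^{−2ε/b}) / 4. -/

import Mathlib

open MeasureTheory

/-- The Laplace distribution `Lap(θ, b)` on `ℝ`, defined through its density
`x ↦ (1/(2b)) exp(−|x − θ|/b)` with respect to Lebesgue measure. -/
noncomputable def laplaceMeasure (θ b : ℝ) : Measure ℝ :=
  volume.withDensity fun x => ENNReal.ofReal ((1 / (2 * b)) * Real.exp (-|x - θ| / b))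

lemma laplace_dens_meas (θ b : ℝ) : Measurable fun x : ℝ =>
    ENNReal.ofReal ((1 / (2 * b)) * Real.exp (-|x - θ| / b)) := by
  fun_prop

lemma laplace_Ioc (θ b : ℝ) (hb : 0 < b) (c d : ℝ) (hc : θ ≤ c) (hd : c ≤ d) :
    laplaceMeasure θ b (Set.Ioc c d) =
      ENNReal.ofReal ((Real.exp (-(c - θ) / b) - Real.exp (-(d - θ) / b)) / 2) := by
  unfold laplaceMeasure
  rw [withDensity_apply _ measurableSet_Ioc, ← ofReal_integral_eq_lintegral_ofReal]
  · congr 1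
    rw [← intervalIntegral.integral_of_le hd]
    have h1 : ∫ x in c..d, (1 / (2 * b)) * Real.exp (-|x - θ| / b)
        = ∫ x in c..d, (1 / (2 * b)) * Real.exp (-(x - θ) / b) := by
      apply intervalIntegral.integral_congr
      intro x hx
      rw [Set.uIcc_of_le hd] at hx
      simp only
      rw [abs_of_nonneg (by linarith [hx.1])]
    rw [h1, intervalIntegral.integral_eq_sub_of_hasDerivAt
      (f := fun x => -(Real.exp (-(x - θ) / b) / 2))]
    · ring
    · intro x _
      have := ((((((hasDerivAt_id x).sub_const θ).neg).div_const b).exp).div_const 2).neg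
      refine this.congr_deriv ?_
      simp only [id, Pi.neg_apply]
      field_simp
    · apply Continuous.intervalIntegrable
      fun_prop
  · apply Continuous.integrableOn_Ioc
    fun_prop
  · exact Filter.Eventually.of_forall fun x => by positivity

lemma laplace_half (θ b : ℝ) (hb : 0 < b) (ε : ℝ) (hε : 0 ≤ ε) :
    ((laplaceMeasure θ b).prod (laplaceMeasure θ b))
        {w : ℝ × ℝ | w.2 ≤ θ ∧ 2 * θ - w.2 < w.1 ∧ w.1 ≤ 2 * θ + 2 * ε - w.2}
      = ENNReal.ofReal ((1 - Real.exp (-2 * ε / b)) / 8) := by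
  have hE : Real.exp (-2 * ε / b) ≤ 1 := by
    rw [Real.exp_le_one_iff]
    exact div_nonpos_of_nonpos_of_nonneg (by linarith) hb.le
  haveI : SFinite (laplaceMeasure θ b) := by unfold laplaceMeasure; infer_instance
  rw [Measure.prod_apply_symm (by measurability)]
  have h1 : ∀ y : ℝ, laplaceMeasure θ b ((fun x => (x, y)) ⁻¹' {w : ℝ × ℝ | w.2 ≤ θ ∧ 2 * θ - w.2 < w.1 ∧ w.1 ≤ 2 * θ + 2 * ε - w.2})
      = (Set.Iic θ).indicator (fun y => ENNReal.ofReal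
        ((1 - Real.exp (-2 * ε / b)) / 2 * Real.exp ((y - θ) / b))) y := by
    intro y
    by_cases hy : y ≤ θ
    · rw [Set.indicator_of_mem (by exact hy)]
      have : ((fun x => (x, y)) ⁻¹' {w : ℝ × ℝ | w.2 ≤ θ ∧ 2 * θ - w.2 < w.1 ∧ w.1 ≤ 2 * θ + 2 * ε - w.2}) = Set.Ioc (2 * θ - y) (2 * θ + 2 * ε - y) := by
        ext x; simp [hy]
      rw [this, laplace_Ioc θ b hb _ _ (by linarith) (by linarith)]
      congr 1
      have e1 : -(2 * θ - y - θ) / b = (y - θ) / b := by ring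
      have e2 : -(2 * θ + 2 * ε - y - θ) / b = -2 * ε / b + (y - θ) / b := by ring
      rw [e1, e2, Real.exp_add]; ring
    · rw [Set.indicator_of_notMem (by exact hy)]
      simp [hy]
  simp_rw [h1]
  rw [lintegral_indicator measurableSet_Iic]
  unfold laplaceMeasure
  rw [setLIntegral_withDensity_eq_setLIntegral_mul _ (laplace_dens_meas θ b) (by fun_prop)
    measurableSet_Iic]
  have h2 : ∫⁻ y in Set.Iic θ, ((fun x : ℝ =>
      ENNReal.ofReal ((1 / (2 * b)) * Real.exp (-|x - θ| / b))) * (fun y => ENNReal.ofReal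
        ((1 - Real.exp (-2 * ε / b)) / 2 * Real.exp ((y - θ) / b)))) y
      = ∫⁻ y in Set.Iic θ, ENNReal.ofReal ((1 - Real.exp (-2 * ε / b)) / (4 * b) *
          Real.exp (- (2 / b * θ)) * Real.exp (2 / b * y)) := by
    apply setLIntegral_congr_fun measurableSet_Iic
    intro y hy
    have hy' : y ≤ θ := hy
    simp only [Pi.mul_apply]
    rw [← ENNReal.ofReal_mul (by positivity), abs_of_nonpos (by linarith)]
    congr 1
    have e1 : -(-(y - θ)) / b = (y - θ) / b := by ring
    have e2 : Real.exp (- (2 / b * θ)) * Real.exp (2 / b * y)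
        = Real.exp ((y - θ) / b) * Real.exp ((y - θ) / b) := by
      rw [← Real.exp_add, ← Real.exp_add]; congr 1; ring
    rw [e1, mul_assoc _ (Real.exp (- (2 / b * θ))), e2]
    field_simp
    ring
  rw [h2, ← ofReal_integral_eq_lintegral_ofReal]
  · congr 1
    rw [integral_const_mul, integral_exp_mul_Iic (by positivity), mul_assoc, ← mul_div_assoc,
      ← Real.exp_add]
    simp
    field_simp
    ring
  · exact (integrableOn_exp_mul_Iic (by positivity) _).const_mul _
  · refine Filter.Eventually.of_forall fun x => ?_
    have : 0 ≤ 1 - Real.exp (-2 * ε / b) := by linarith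
    simp only [Pi.zero_apply]
    positivity

/-- **CDF of the deviation functional for the Laplace model.**
For `X, Y` i.i.d. `Lap(θ, b)` and every `ε ≥ 0`,
`P(min(X,Y) ≤ θ ≤ max(X,Y) and 0 < (X+Y)/2 − θ ≤ ε) = (1 − e^{−2ε/b})/4`. -/
theorem stmt14 (θ b : ℝ) (hb : 0 < b) (ε : ℝ) (hε : 0 ≤ ε) :
    ((laplaceMeasure θ b).prod (laplaceMeasure θ b))
        {w : ℝ × ℝ | (min w.1 w.2 ≤ θ ∧ θ ≤ max w.1 w.2) ∧
          0 < (w.1 + w.2) / 2 - θ ∧ (w.1 + w.2) / 2 - θ ≤ ε}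
      = ENNReal.ofReal ((1 - Real.exp (-2 * ε / b)) / 4) := by
  have hE : Real.exp (-2 * ε / b) ≤ 1 := by
    rw [Real.exp_le_one_iff]
    exact div_nonpos_of_nonpos_of_nonneg (by linarith) hb.le
  haveI : SFinite (laplaceMeasure θ b) := by unfold laplaceMeasure; infer_instance
  set A : Set (ℝ × ℝ) :=
    {w : ℝ × ℝ | w.2 ≤ θ ∧ 2 * θ - w.2 < w.1 ∧ w.1 ≤ 2 * θ + 2 * ε - w.2} with hA
  have mA : MeasurableSet A := by measurability
  have hS : {w : ℝ × ℝ | (min w.1 w.2 ≤ θ ∧ θ ≤ max w.1 w.2) ∧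
          0 < (w.1 + w.2) / 2 - θ ∧ (w.1 + w.2) / 2 - θ ≤ ε} = A ∪ Prod.swap ⁻¹' A := by
    ext ⟨x, y⟩
    simp only [hA, Set.mem_setOf_eq, Set.mem_union, Set.mem_preimage, Prod.swap_prod_mk,
      min_le_iff, le_max_iff]
    constructor
    · rintro ⟨⟨h1 | h1, -⟩, h3, h4⟩
      · right; refine ⟨h1, ?_, ?_⟩ <;> linarith
      · left; refine ⟨h1, ?_, ?_⟩ <;> linarith
    · rintro (⟨h1, h2, h3⟩ | ⟨h1, h2, h3⟩)
      · refine ⟨⟨Or.inr h1, Or.inl ?_⟩, ?_, ?_⟩ <;> linarith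
      · refine ⟨⟨Or.inl h1, Or.inr ?_⟩, ?_, ?_⟩ <;> linarith
  have hdis : Disjoint A (Prod.swap ⁻¹' A) := by
    rw [Set.disjoint_left]
    rintro ⟨x, y⟩ ⟨h1, h2, _⟩ ⟨h4, h5, _⟩
    simp only [Prod.swap_prod_mk] at *
    linarith
  rw [hS, measure_union hdis (measurable_swap mA), ← Measure.map_apply measurable_swap mA,
    Measure.prod_swap, laplace_half θ b hb ε hε, ← ENNReal.ofReal_add (by linarith) (by linarith)]
  congr 1
  ring
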